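/- Let a > 1 be an irrational real number with continued fraction expansion [a₀; a₁, a₂, …], differences βₖ = qₖa − pₖ, and complete quotients ζₖ. Then every real number c with −1/ζ₁ ≤ c < 1 − 1/ζ₁ can be written uniquely as c = Σ_{k=0}^∞ b_{k+1}·βₖ, where bₖ ∈ ℕ, 0 ≤ b₁ < a₁, 0 ≤ bₖ ≤ aₖ for k > 1, bₖ = 0 whenever b_{k+1} = a_{k+1}, and bₖ < aₖ for infinitely many odd k. -/

import Mathlib

open Real

/-- The sequence of complete quotients of `a`: `ζ₀ = a`, `ζ_{k+1} = 1/(ζₖ - ⌊ζₖ⌋)`. -/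
noncomputable def cfZeta (a : ℝ) : ℕ → ℝ
  | 0 => a
  | k + 1 => (cfZeta a k - ⌊cfZeta a k⌋)⁻¹

/-- The partial quotients of the continued fraction expansion `[a₀; a₁, a₂, …]` of `a`. -/
noncomputable def cfA (a : ℝ) (k : ℕ) : ℤ := ⌊cfZeta a k⌋

/-- Denominators of the convergents, shifted by one: `cfQ a (k+1) = qₖ`, with
`q₋₁ = 0`, `q₀ = 1` and `q_{k+1} = a_{k+1}·qₖ + q_{k-1}`. -/
noncomputable def cfQ (a : ℝ) : ℕ → ℤ
  | 0 => 0
  | 1 => 1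
  | k + 2 => cfA a (k + 1) * cfQ a (k + 1) + cfQ a k

/-- Numerators of the convergents, shifted by one: `cfP a (k+1) = pₖ`, with
`p₋₁ = 1`, `p₀ = a₀` and `p_{k+1} = a_{k+1}·pₖ + p_{k-1}`. -/
noncomputable def cfP (a : ℝ) : ℕ → ℤ
  | 0 => 1
  | 1 => cfA a 0
  | k + 2 => cfA a (k + 1) * cfP a (k + 1) + cfP a k

/-- The `k`-th difference `βₖ = qₖ·a − pₖ`. -/
noncomputable def cfBeta (a : ℝ) (k : ℕ) : ℝ := (cfQ a (k + 1) : ℝ) * a - (cfP a (k + 1) : ℝ)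

/-- `m` is the length of the minimal period of the continued fraction expansion of `a`
(periodicity from index 1 onward). -/
def IsMinPeriod (a : ℝ) (m : ℕ) : Prop :=
  0 < m ∧ (∀ k, 1 ≤ k → cfA a (k + m) = cfA a k) ∧
    ∀ m', 0 < m' → (∀ k, 1 ≤ k → cfA a (k + m') = cfA a k) → m ≤ m'

open Filter Topology Finset

/-- An abstract system of (absolute values of) differences: `D k` plays the role of `|β_{k-1}|` and
`A k` that of the partial quotient `a_{k+1}`. -/
structure IsDiffSystem (A : ℕ → ℤ) (D : ℕ → ℝ) : Prop where
  pos : ∀ k, 0 < D k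
  lt : ∀ k, D (k + 1) < D k
  one_le : ∀ k, 1 ≤ A k
  eq_add : ∀ k, D k = A k * D (k + 1) + D (k + 2)

/-- The values taken by the tails `∑_{j ≥ k} b j * (-1) ^ j * D (j + 1)` of admissible digit
sequences; under `r` the digit `b k` is not allowed to be maximal. -/
def InWindow (D : ℕ → ℝ) (k : ℕ) (r : Prop) (t : ℝ) : Prop :=
  (Even k → -D (k + 1) ≤ t ∧ t < D k ∧ (r → t < D k - D (k + 1))) ∧
  (Odd k → -D k ≤ t ∧ t < D (k + 1) ∧ (r → D (k + 1) - D k ≤ t))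

theorem InWindow.abs_le {A : ℕ → ℤ} {D : ℕ → ℝ} (h : IsDiffSystem A D) {k : ℕ} {r : Prop} {t : ℝ}
    (ht : InWindow D k r t) : |t| ≤ D k := by
  have := h.lt k
  rw [_root_.abs_le]
  rcases Nat.even_or_odd k with hk | hk
  · have := ht.1 hk
    constructor <;> linarith
  · have := ht.2 hk
    constructor <;> linarith

theorem IsDiffSystem.tendsto_zero {A : ℕ → ℤ} {D : ℕ → ℝ} (h : IsDiffSystem A D) :
    Tendsto D atTop (𝓝 0) := by
  have hanti : Antitone D := antitone_nat_of_succ_le fun k => (h.lt k).le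
  have hlim := tendsto_atTop_ciInf hanti ⟨0, by rintro _ ⟨k, rfl⟩; exact (h.pos k).le⟩
  set l := ⨅ k, D k
  have hl : 0 ≤ l := ge_of_tendsto' hlim fun k => (h.pos k).le
  have hl' : l + l ≤ l := by
    refine le_of_tendsto_of_tendsto' (((tendsto_add_atTop_iff_nat 1).2 hlim).add
      ((tendsto_add_atTop_iff_nat 2).2 hlim)) hlim fun k => ?_
    have h1 : (1 : ℝ) ≤ A k := by exact_mod_cast h.one_le k
    have := h.eq_add k
    nlinarith [h.pos (k + 1)]
  rwa [show l = 0 by linarith] at hlim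

theorem IsDiffSystem.summable {A : ℕ → ℤ} {D : ℕ → ℝ} (h : IsDiffSystem A D) {b : ℕ → ℕ}
    (hb : ∀ k, (b k : ℤ) ≤ A k) : Summable fun k => (b k : ℝ) * ((-1) ^ k * D (k + 1)) := by
  refine Summable.of_abs (summable_of_sum_range_le (c := D 0 + D 1) (fun k => abs_nonneg _)
    fun n => ?_)
  have key : ∑ k ∈ range n, |(b k : ℝ) * ((-1) ^ k * D (k + 1))| ≤
      D 0 + D 1 - D n - D (n + 1) := by
    induction n with
    | zero => simp
    | succ n ih =>
      rw [sum_range_succ, abs_mul, abs_mul, abs_pow, abs_neg, abs_one, one_pow, one_mul,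
        abs_of_pos (h.pos _), Nat.abs_cast]
      have h1 : (b n : ℝ) ≤ A n := by exact_mod_cast hb n
      have := h.eq_add n
      nlinarith [h.pos (n + 1)]
  linarith [h.pos n, h.pos (n + 1)]

theorem IsDiffSystem.exists_digit {A : ℕ → ℤ} {D : ℕ → ℝ} (h : IsDiffSystem A D) {k : ℕ}
    {r : Prop} {t : ℝ} (ht : InWindow D k r t) :
    ∃ b : ℕ, (b : ℤ) ≤ A k ∧ (r → (b : ℤ) < A k) ∧
      InWindow D (k + 1) (b ≠ 0) (t - b * ((-1) ^ k * D (k + 1))) := by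
  have hp := h.pos (k + 1)
  have hp' := h.pos (k + 2)
  have hrec := h.eq_add k
  have hlt := h.lt (k + 1)
  have hA : (1 : ℝ) ≤ A k := by exact_mod_cast h.one_le k
  rcases Nat.even_or_odd k with hk | hk
  · obtain ⟨hlo, hup, hr⟩ := ht.1 hk
    have hnot : ¬ Even (k + 1) := by simpa [Nat.even_add_one] using hk
    simp only [InWindow, hk.neg_one_pow, one_mul, hnot, false_imp_iff, true_and, hk.add_one,
      true_imp_iff]
    by_cases hsmall : t < D (k + 2)
    · exact ⟨0, by simpa using (h.one_le k).trans' zero_le_one,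
        fun _ => by simpa using zero_lt_one.trans_le (h.one_le k), by simpa using ⟨hlo, hsmall⟩⟩
    · have hx : 0 ≤ (t - D (k + 2)) / D (k + 1) := div_nonneg (by linarith) hp.le
      have h1 := Nat.floor_le hx
      have h2 := Nat.lt_floor_add_one ((t - D (k + 2)) / D (k + 1))
      rw [le_div_iff₀ hp] at h1
      rw [div_lt_iff₀ hp] at h2
      generalize ⌊(t - D (k + 2)) / D (k + 1)⌋₊ = n at h1 h2
      refine ⟨n + 1, ?_, fun hr' => ?_, ?_⟩
      · have : (n : ℝ) < A k := by
          refine lt_of_mul_lt_mul_right ?_ hp.le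
          linarith
        have : (n : ℤ) < A k := by exact_mod_cast this
        push_cast; omega
      · have := hr hr'
        have : (n + 1 : ℝ) < A k := by
          refine lt_of_mul_lt_mul_right ?_ hp.le
          linarith
        exact_mod_cast this
      · push_cast
        refine ⟨by linarith, by linarith, fun _ => by linarith⟩
  · obtain ⟨hlo, hup, hr⟩ := ht.2 hk
    have hnot : ¬ Odd (k + 1) := by simpa [Nat.odd_add_one] using hk
    simp only [InWindow, hk.neg_one_pow, neg_mul, one_mul, hnot, false_imp_iff, and_true,
      hk.add_one, true_imp_iff, mul_neg, sub_neg_eq_add]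
    by_cases hsmall : -D (k + 2) ≤ t
    · exact ⟨0, by simpa using (h.one_le k).trans' zero_le_one,
        fun _ => by simpa using zero_lt_one.trans_le (h.one_le k), by simpa using ⟨hsmall, hup⟩⟩
    · have hx : 0 < (-t - D (k + 2)) / D (k + 1) := div_pos (by linarith) hp
      have h1 := Nat.le_ceil ((-t - D (k + 2)) / D (k + 1))
      have h2 := Nat.ceil_lt_add_one hx.le
      rw [div_le_iff₀ hp] at h1
      rw [← sub_lt_iff_lt_add, lt_div_iff₀ hp] at h2
      generalize ⌈(-t - D (k + 2)) / D (k + 1)⌉₊ = n at h1 h2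
      refine ⟨n, ?_, fun hr' => ?_, by linarith, by linarith, fun _ => by linarith⟩
      · have : (n - 1 : ℝ) < A k := by
          refine lt_of_mul_lt_mul_right ?_ hp.le
          linarith
        have : (n - 1 : ℤ) < A k := by exact_mod_cast this
        omega
      · have := hr hr'
        have : (n : ℝ) - 1 < A k - 1 := by
          refine lt_of_mul_lt_mul_right ?_ hp.le
          linarith
        have : (n : ℝ) < A k := by linarith
        exact_mod_cast this

theorem IsDiffSystem.digit_le {A : ℕ → ℤ} {D : ℕ → ℝ} (h : IsDiffSystem A D) {k b b' : ℕ}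
    {t : ℝ} (ht : InWindow D (k + 1) (b ≠ 0) (t - b * ((-1) ^ k * D (k + 1))))
    (ht' : InWindow D (k + 1) (b' ≠ 0) (t - b' * ((-1) ^ k * D (k + 1)))) : b' ≤ b := by
  by_contra! hlt
  have hb : (b : ℝ) + 1 ≤ b' := by exact_mod_cast hlt
  have hp := h.pos (k + 1)
  have hb0 : b' ≠ 0 := by omega
  have hmul := mul_le_mul_of_nonneg_right hb hp.le
  rcases Nat.even_or_odd k with hk | hk
  · have h1 := ht.2 hk.add_one
    have h2 := (ht'.2 hk.add_one).2.2 hb0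
    simp only [hk.neg_one_pow, one_mul] at h1 h2
    linarith
  · have h1 := ht.1 hk.add_one
    have h2 := (ht'.1 hk.add_one).2.2 hb0
    simp only [hk.neg_one_pow] at h1 h2
    linarith

/-- Distance from the tail `t` to the upper end of its window. -/
noncomputable def upperGap (D : ℕ → ℝ) (k : ℕ) (t : ℝ) : ℝ :=
  (if Even k then D k else D (k + 1)) - t

/-- Distance from the tail `t` to the lower end of its window. -/
noncomputable def lowerGap (D : ℕ → ℝ) (k : ℕ) (t : ℝ) : ℝ :=
  t + (if Even k then D (k + 1) else D k)

theorem IsDiffSystem.upperGap_eq {A : ℕ → ℤ} {D : ℕ → ℝ} (h : IsDiffSystem A D) (k : ℕ)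
    (b t : ℝ) : upperGap D k t = (if Even k then A k - b else b) * D (k + 1) +
      upperGap D (k + 1) (t - b * ((-1) ^ k * D (k + 1))) := by
  have := h.eq_add k
  rcases Nat.even_or_odd k with hk | hk
  · simp only [upperGap, Nat.even_add_one, hk, hk.neg_one_pow, if_true, not_true, if_false]
    linarith
  · simp only [upperGap, Nat.even_add_one, Nat.not_even_iff_odd.2 hk, hk.neg_one_pow, if_true,
      not_false_iff, if_false]
    linarith

theorem IsDiffSystem.lowerGap_eq {A : ℕ → ℤ} {D : ℕ → ℝ} (h : IsDiffSystem A D) (k : ℕ)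
    (b t : ℝ) : lowerGap D k t = (if Even k then b else A k - b) * D (k + 1) +
      lowerGap D (k + 1) (t - b * ((-1) ^ k * D (k + 1))) := by
  have := h.eq_add k
  rcases Nat.even_or_odd k with hk | hk
  · simp only [lowerGap, Nat.even_add_one, hk, hk.neg_one_pow, if_true, not_true, if_false]
    linarith
  · simp only [lowerGap, Nat.even_add_one, Nat.not_even_iff_odd.2 hk, hk.neg_one_pow, if_true,
      not_false_iff, if_false]
    linarith

theorem IsDiffSystem.tendsto_end {A : ℕ → ℤ} {D : ℕ → ℝ} (h : IsDiffSystem A D) (p : ℕ → Prop)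
    [DecidablePred p] : Tendsto (fun k => if p k then D k else D (k + 1)) atTop (𝓝 0) :=
  squeeze_zero (fun k => by split_ifs <;> exact (h.pos _).le)
    (fun k => by split_ifs <;> linarith [h.lt k]) h.tendsto_zero

theorem IsDiffSystem.tendsto_upperGap {A : ℕ → ℤ} {D : ℕ → ℝ} (h : IsDiffSystem A D) {T : ℕ → ℝ}
    (hT : Tendsto T atTop (𝓝 0)) : Tendsto (fun k => upperGap D k (T k)) atTop (𝓝 0) := by
  simpa [upperGap] using (h.tendsto_end fun k => Even k).sub hT

theorem IsDiffSystem.tendsto_lowerGap {A : ℕ → ℤ} {D : ℕ → ℝ} (h : IsDiffSystem A D) {T : ℕ → ℝ}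
    (hT : Tendsto T atTop (𝓝 0)) : Tendsto (fun k => lowerGap D k (T k)) atTop (𝓝 0) := by
  simpa only [lowerGap, ite_not, add_zero] using hT.add (h.tendsto_end fun k => ¬ Even k)

/-- The tails of an admissible digit sequence lie in their windows. -/
theorem IsDiffSystem.inWindow_tail {A : ℕ → ℤ} {D : ℕ → ℝ} (h : IsDiffSystem A D) {b : ℕ → ℕ}
    {T : ℕ → ℝ} (hb : ∀ k, (b k : ℤ) ≤ A k)
    (hinf : ∀ n, ∃ k, n ≤ k ∧ Odd (k + 1) ∧ (b k : ℤ) < A k)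
    (hT : ∀ k, T (k + 1) = T k - b k * ((-1) ^ k * D (k + 1)))
    (hT0 : Tendsto T atTop (𝓝 0)) (k : ℕ) : InWindow D k ((b k : ℤ) < A k) (T k) := by
  have hbR : ∀ k, (b k : ℝ) ≤ A k := fun k => by exact_mod_cast hb k
  have hU : ∀ k, upperGap D k (T k) = _ := fun k => h.upperGap_eq k (b k) (T k)
  have hL : ∀ k, lowerGap D k (T k) = _ := fun k => h.lowerGap_eq k (b k) (T k)
  simp only [← hT] at hU hL
  have hUanti : Antitone fun k => upperGap D k (T k) := antitone_nat_of_succ_le fun k => by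
    rw [hU k]
    refine le_add_of_nonneg_left (mul_nonneg ?_ (h.pos _).le)
    split_ifs
    · linarith [hbR k]
    · positivity
  have hLanti : Antitone fun k => lowerGap D k (T k) := antitone_nat_of_succ_le fun k => by
    rw [hL k]
    refine le_add_of_nonneg_left (mul_nonneg ?_ (h.pos _).le)
    split_ifs
    · positivity
    · linarith [hbR k]
  have hL0 : ∀ k, 0 ≤ lowerGap D k (T k) := hLanti.le_of_tendsto (h.tendsto_lowerGap hT0)
  have hU0 : ∀ k, 0 < upperGap D k (T k) := fun k => by
    obtain ⟨j, hkj, hj, hbj⟩ := hinf k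
    have hje : Even j := by simpa [Nat.odd_add_one] using hj
    refine lt_of_lt_of_le ?_ (hUanti hkj)
    have hbj' : (b j : ℝ) < A j := by exact_mod_cast hbj
    simp only [hU j, hje, if_true]
    exact add_pos_of_pos_of_nonneg (mul_pos (by linarith) (h.pos _))
      (hUanti.le_of_tendsto (h.tendsto_upperGap hT0) (j + 1))
  have hgap : (b k : ℤ) < A k → D (k + 1) ≤ (A k - b k) * D (k + 1) := fun hlt => by
    have : (b k : ℝ) + 1 ≤ A k := by exact_mod_cast hlt
    exact le_mul_of_one_le_left (h.pos _).le (by linarith)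
  constructor
  · intro hk
    have e1 := hU0 k
    have e2 := hL0 k
    refine ⟨?_, ?_, fun hlt => ?_⟩
    · simp only [lowerGap, hk, if_true] at e2
      linarith
    · simp only [upperGap, hk, if_true] at e1
      linarith
    · have e3 := hU k
      have e4 := hU0 (k + 1)
      have e5 := hgap hlt
      rw [upperGap] at e3
      simp only [hk, if_true] at e3
      linarith
  · intro hk
    have hk' := Nat.not_even_iff_odd.2 hk
    have e1 := hU0 k
    have e2 := hL0 k
    refine ⟨?_, ?_, fun hlt => ?_⟩
    · simp only [lowerGap, hk', if_false] at e2
      linarith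
    · simp only [upperGap, hk', if_false] at e1
      linarith
    · have e3 := hL k
      have e4 := hL0 (k + 1)
      have e5 := hgap hlt
      rw [lowerGap] at e3
      simp only [hk', if_false] at e3
      linarith

/-- A sequence of digits all of whose tails lie in the windows is not eventually maximal at even
positions. -/
theorem IsDiffSystem.exists_digit_lt {A : ℕ → ℤ} {D : ℕ → ℝ} (h : IsDiffSystem A D) {b : ℕ → ℕ}
    {T : ℕ → ℝ} {r : ℕ → Prop} (hb : ∀ k, (b k : ℤ) ≤ A k)
    (hadm : ∀ k, (b (k + 1) : ℤ) = A (k + 1) → b k = 0)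
    (hT : ∀ k, T (k + 1) = T k - b k * ((-1) ^ k * D (k + 1)))
    (hw : ∀ k, InWindow D k (r k) (T k)) (n : ℕ) :
    ∃ k, n ≤ k ∧ Odd (k + 1) ∧ (b k : ℤ) < A k := by
  by_contra! hcon
  have hmax : ∀ k, n ≤ k → Even k → (b k : ℤ) = A k := fun k hk he =>
    (hb k).antisymm (hcon k hk he.add_one)
  have hT0 : Tendsto T atTop (𝓝 0) :=
    squeeze_zero_norm (fun k => (hw k).abs_le h) h.tendsto_zero
  have hstep : ∀ k, n ≤ k → upperGap D k (T k) = upperGap D (k + 1) (T (k + 1)) := by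
    intro k hk
    rw [h.upperGap_eq k (b k), ← hT, add_eq_right]
    rcases Nat.even_or_odd k with he | ho
    · have : (b k : ℝ) = A k := by exact_mod_cast hmax k hk he
      simp [he, this]
    · simp [Nat.not_even_iff_odd.2 ho, hadm k (hmax (k + 1) (by omega) ho.add_one)]
  have hconst : ∀ j, upperGap D (n + j) (T (n + j)) = upperGap D n (T n) := by
    intro j
    induction j with
    | zero => rfl
    | succ j ih => rw [← ih, hstep (n + j) (by omega)]; rfl
  have hlim : Tendsto (fun j => upperGap D (n + j) (T (n + j))) atTop (𝓝 0) := by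
    simpa only [add_comm n] using (tendsto_add_atTop_iff_nat n).2 (h.tendsto_upperGap hT0)
  simp only [hconst] at hlim
  have h0 : upperGap D n (T n) = 0 := tendsto_nhds_unique tendsto_const_nhds hlim
  rcases Nat.even_or_odd n with he | ho
  · have := (hw n).1 he
    simp only [upperGap, he, if_true] at h0
    linarith
  · have := (hw n).2 ho
    simp only [upperGap, Nat.not_even_iff_odd.2 ho, if_false] at h0
    linarith

theorem IsDiffSystem.existsUnique_digits {A : ℕ → ℤ} {D : ℕ → ℝ} (h : IsDiffSystem A D) {c : ℝ}
    (h1 : -D 1 ≤ c) (h2 : c < D 0 - D 1) :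
    ∃! b : ℕ → ℕ, (b 0 : ℤ) < A 0 ∧ (∀ k : ℕ, 1 ≤ k → (b k : ℤ) ≤ A k) ∧
      (∀ k : ℕ, (b (k + 1) : ℤ) = A (k + 1) → b k = 0) ∧
      (∀ n : ℕ, ∃ k : ℕ, n ≤ k ∧ Odd (k + 1) ∧ (b k : ℤ) < A k) ∧
      c = ∑' k : ℕ, (b k : ℝ) * ((-1) ^ k * D (k + 1)) := by
  refine existsUnique_of_exists_of_unique ?_ ?_
  · have hdigit : ∀ (k m : ℕ) (t : ℝ), ∃ b : ℕ, InWindow D k (m ≠ 0) t →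
        (b : ℤ) ≤ A k ∧ (m ≠ 0 → (b : ℤ) < A k) ∧
          InWindow D (k + 1) (b ≠ 0) (t - b * ((-1) ^ k * D (k + 1))) := fun k m t => by
      by_cases ht : InWindow D k (m ≠ 0) t
      · obtain ⟨b, hb⟩ := h.exists_digit ht
        exact ⟨b, fun _ => hb⟩
      · exact ⟨0, fun h => absurd h ht⟩
    choose f hf using hdigit
    -- the state consists of the previous digit and the current tail
    let s : ℕ → ℕ × ℝ := fun n => Nat.rec (1, c) (fun k p =>
      (f k p.1 p.2, p.2 - f k p.1 p.2 * ((-1) ^ k * D (k + 1)))) n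
    have hs : ∀ k, InWindow D k ((s k).1 ≠ 0) (s k).2 := by
      intro k
      induction k with
      | zero =>
        refine ⟨fun _ => ⟨h1, ?_, fun _ => h2⟩, fun h => by simp at h⟩
        exact h2.trans (by linarith [h.pos 1])
      | succ k ih => exact (hf k _ _ ih).2.2
    let b : ℕ → ℕ := fun k => (s (k + 1)).1
    have hT : ∀ k, (s (k + 1)).2 = (s k).2 - b k * ((-1) ^ k * D (k + 1)) := fun k => rfl
    have hb : ∀ k, (b k : ℤ) ≤ A k := fun k => (hf k _ _ (hs k)).1
    have hlt : ∀ k, (s k).1 ≠ 0 → (b k : ℤ) < A k := fun k => (hf k _ _ (hs k)).2.1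
    have hadm : ∀ k, (b (k + 1) : ℤ) = A (k + 1) → b k = 0 := fun k he => by
      by_contra h0
      exact (hlt (k + 1) h0).ne he
    refine ⟨b, hlt 0 one_ne_zero, fun k _ => hb k, hadm,
      h.exists_digit_lt hb hadm hT hs, ?_⟩
    have hT0 : Tendsto (fun k => (s k).2) atTop (𝓝 0) :=
      squeeze_zero_norm (fun k => (hs k).abs_le h) h.tendsto_zero
    have hsum : ∀ n, ∑ k ∈ range n, (b k : ℝ) * ((-1) ^ k * D (k + 1)) = c - (s n).2 := by
      intro n
      induction n with
      | zero => exact (sub_self c).symm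
      | succ n ih => rw [sum_range_succ, ih, hT]; ring
    have hlim := (h.summable hb).hasSum.tendsto_sum_nat
    simp only [hsum] at hlim
    have hlim' := hT0.const_sub c
    rw [sub_zero] at hlim'
    exact tendsto_nhds_unique hlim' hlim
  · have htail : ∀ b : ℕ → ℕ, ((b 0 : ℤ) < A 0 ∧ (∀ k : ℕ, 1 ≤ k → (b k : ℤ) ≤ A k) ∧
        (∀ k : ℕ, (b (k + 1) : ℤ) = A (k + 1) → b k = 0) ∧
        (∀ n : ℕ, ∃ k : ℕ, n ≤ k ∧ Odd (k + 1) ∧ (b k : ℤ) < A k) ∧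
        c = ∑' k : ℕ, (b k : ℝ) * ((-1) ^ k * D (k + 1))) →
        ∃ T : ℕ → ℝ, T 0 = c ∧ (∀ k, T (k + 1) = T k - b k * ((-1) ^ k * D (k + 1))) ∧
          ∀ k, InWindow D (k + 1) (b k ≠ 0) (T (k + 1)) := by
      rintro b ⟨hb0, hb1, hadm, hinf, hc⟩
      have hb : ∀ k, (b k : ℤ) ≤ A k
        | 0 => hb0.le
        | k + 1 => hb1 _ (by omega)
      have hT : ∀ k, c - ∑ j ∈ range (k + 1), (b j : ℝ) * ((-1) ^ j * D (j + 1)) =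
          c - ∑ j ∈ range k, (b j : ℝ) * ((-1) ^ j * D (j + 1)) -
            b k * ((-1) ^ k * D (k + 1)) := fun k => by
        rw [sum_range_succ]; ring
      have hT0 : Tendsto (fun k => c - ∑ j ∈ range k, (b j : ℝ) * ((-1) ^ j * D (j + 1)))
          atTop (𝓝 0) := by
        have := (h.summable hb).hasSum.tendsto_sum_nat.const_sub c
        rwa [← hc, sub_self] at this
      refine ⟨fun k => c - ∑ j ∈ range k, (b j : ℝ) * ((-1) ^ j * D (j + 1)), by simp, hT,
        fun k => ?_⟩
      have hw := h.inWindow_tail (T := fun k => c - ∑ j ∈ range k,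
        (b j : ℝ) * ((-1) ^ j * D (j + 1))) hb hinf hT hT0 (k + 1)
      have himp : b k ≠ 0 → (b (k + 1) : ℤ) < A (k + 1) := fun h0 =>
        lt_of_le_of_ne (hb _) fun he => h0 (hadm k he)
      exact ⟨fun he => ⟨(hw.1 he).1, (hw.1 he).2.1, fun h0 => (hw.1 he).2.2 (himp h0)⟩,
        fun ho => ⟨(hw.2 ho).1, (hw.2 ho).2.1, fun h0 => (hw.2 ho).2.2 (himp h0)⟩⟩
    intro b b' hb hb'
    obtain ⟨T, hT0, hT, hw⟩ := htail b hb
    obtain ⟨T', hT0', hT', hw'⟩ := htail b' hb'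
    have hdig : ∀ k, T k = T' k → b k = b' k := fun k he => by
      have e1 := hw k
      have e2 := hw' k
      rw [hT] at e1
      rw [hT', ← he] at e2
      exact (h.digit_le e2 e1).antisymm (h.digit_le e1 e2)
    have heq : ∀ k, T k = T' k := fun k => by
      induction k with
      | zero => rw [hT0, hT0']
      | succ k ih => rw [hT, hT', ih, hdig k ih]
    exact funext fun k => hdig k (heq k)

theorem irrational_cfZeta {a : ℝ} (hirr : Irrational a) : ∀ k, Irrational (cfZeta a k)
  | 0 => hirr
  | k + 1 => ((irrational_cfZeta hirr k).sub_intCast _).inv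

theorem one_lt_cfZeta_succ {a : ℝ} (hirr : Irrational a) (k : ℕ) : 1 < cfZeta a (k + 1) :=
  (one_lt_inv₀ (Int.fract_pos.2 ((irrational_cfZeta hirr k).ne_int _))).2 (Int.fract_lt_one _)

theorem cfZeta_eq_add_inv (a : ℝ) (k : ℕ) :
    cfZeta a k = cfA a k + (cfZeta a (k + 1))⁻¹ := by
  simp [cfZeta, cfA]

/-- The product `∏_{i < k} ζ_{i+1}⁻¹`, which equals `|β_{k-1}|`. -/
noncomputable def cfAbsDiff (a : ℝ) (k : ℕ) : ℝ := ∏ i ∈ range k, (cfZeta a (i + 1))⁻¹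

theorem isDiffSystem_cfAbsDiff {a : ℝ} (hirr : Irrational a) :
    IsDiffSystem (fun k => cfA a (k + 1)) (cfAbsDiff a) := by
  have hz := fun k => zero_lt_one.trans (one_lt_cfZeta_succ hirr k)
  have hpos : ∀ k, 0 < cfAbsDiff a k := fun k => prod_pos fun i _ => inv_pos.2 (hz i)
  refine ⟨hpos, fun k => ?_, fun k => ?_, fun k => ?_⟩
  · rw [cfAbsDiff, prod_range_succ]
    exact mul_lt_of_lt_one_right (hpos k) (inv_lt_one_of_one_lt₀ (one_lt_cfZeta_succ hirr k))
  · exact Int.le_floor.2 (by exact_mod_cast (one_lt_cfZeta_succ hirr k).le)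
  · have e := cfZeta_eq_add_inv a (k + 1)
    have hne := (hz k).ne'
    simp only [cfAbsDiff, prod_range_succ]
    rw [eq_sub_of_add_eq' e.symm]
    field_simp
    ring

theorem cfBeta_eq {a : ℝ} (hirr : Irrational a) (k : ℕ) :
    cfBeta a k = (-1) ^ k * cfAbsDiff a (k + 1) := by
  have h := isDiffSystem_cfAbsDiff hirr
  have e := cfZeta_eq_add_inv a 0
  have h1 : cfAbsDiff a 1 = a - cfA a 0 := by
    rw [eq_sub_iff_add_eq', cfAbsDiff, prod_range_one]
    exact e.symm
  induction k using Nat.twoStepInduction with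
  | zero => simp [cfBeta, cfQ, cfP, h1]
  | one =>
    have h2 := h.eq_add 0
    have h0 : cfAbsDiff a 0 = 1 := prod_range_zero _
    simp only [zero_add, h0, h1] at h2
    simp only [cfBeta, cfQ, cfP]
    push_cast
    linarith
  | more k ih1 ih2 =>
    have h2 := h.eq_add (k + 1)
    have : cfBeta a (k + 2) = cfA a (k + 2) * cfBeta a (k + 1) + cfBeta a k := by
      simp only [cfBeta, cfQ, cfP]
      push_cast
      ring
    rw [this, ih1, ih2, h2]
    ring

theorem ostrowski_representation_real (a : ℝ) (ha : 1 < a) (hirr : Irrational a)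
    (c : ℝ) (h1 : -(cfZeta a 1)⁻¹ ≤ c) (h2 : c < 1 - (cfZeta a 1)⁻¹) :
    ∃! b : ℕ → ℕ,
      (b 0 : ℤ) < cfA a 1 ∧
      (∀ k : ℕ, 1 ≤ k → (b k : ℤ) ≤ cfA a (k + 1)) ∧
      (∀ k : ℕ, (b (k + 1) : ℤ) = cfA a (k + 2) → b k = 0) ∧
      (∀ n : ℕ, ∃ k : ℕ, n ≤ k ∧ Odd (k + 1) ∧ (b k : ℤ) < cfA a (k + 1)) ∧
      c = ∑' k : ℕ, (b k : ℝ) * cfBeta a k := by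
  have h := (isDiffSystem_cfAbsDiff hirr).existsUnique_digits (c := c)
    (by simpa [cfAbsDiff] using h1) (by simpa [cfAbsDiff] using h2)
  simpa only [cfBeta_eq hirr] using h
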